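/- arXiv:1011.5561 — 2 statements merged into one kernel-verified Lean document; each statement's English description precedes it below -/
import Mathlib

section
/- Let n ≥ 1, m ≥ 0, 1 < r < 2, and set σ_{r,m} = (n/2)(1/r − 1/2) + m/2. Suppose h : [0,∞) → ℝ is measurable with |h(s)| ≤ C_h (1+s)^{−j} for all s ≥ 0, for some C_h > 0 and some j > 2σ_{r,m}. Then there is a constant C = C(h,n,m,r) such that for every t ≥ 1, ( ∫_{|k|≤1} |k|^{2m r/(2−r)} |h(|k|² t)|^{r/(2−r)} dk )^{(2−r)/r} ≤ C t^{−2σ_{r,m}}. -/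
open MeasureTheory Real Function
open scoped RealInnerProductSpace FourierTransform ENNReal

noncomputable section

abbrev Vn (n : ℕ) := EuclideanSpace ℝ (Fin n)

/-- the Japanese bracket `⟨v⟩ = (1+|v|²)^{1/2}` -/
def jap {n : ℕ} (v : Vn n) : ℝ := Real.sqrt (1 + ‖v‖ ^ 2)

/-- the Maxwellian `μ(v) = (2π)^{-n/2} e^{-|v|²/2}` -/
def Mx {n : ℕ} (v : Vn n) : ℝ := (2 * Real.pi) ^ (-(n : ℝ) / 2) * Real.exp (-‖v‖ ^ 2 / 2)

/-- A non cut-off Boltzmann collision kernel `B(v-v_*,σ) = Φ(|v-v_*|) b(cos θ)`,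
with `Φ(|z|) = C_Φ |z|^γ`, supported on `cos θ ≥ 0`, whose angular factor satisfies
`c_b θ^{-1-2s} ≤ sin^{n-2}θ b(cos θ) ≤ c_b⁻¹ θ^{-1-2s}` on `(0, π/2]`. -/
structure Kernel (n : ℕ) where
  γ : ℝ
  s : ℝ
  CΦ : ℝ
  cb : ℝ
  bang : ℝ → ℝ
  s_mem : s ∈ Set.Ioo (0 : ℝ) 1
  CΦ_pos : 0 < CΦ
  cb_pos : 0 < cb
  supp_b : ∀ t < (0 : ℝ), bang t = 0
  ang_lower : ∀ θ ∈ Set.Ioc (0 : ℝ) (Real.pi / 2),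
    cb / θ ^ (1 + 2 * s) ≤ Real.sin θ ^ ((n : ℝ) - 2) * bang (Real.cos θ)
  ang_upper : ∀ θ ∈ Set.Ioc (0 : ℝ) (Real.pi / 2),
    Real.sin θ ^ ((n : ℝ) - 2) * bang (Real.cos θ) ≤ 1 / (cb * θ ^ (1 + 2 * s))

namespace Kernel

variable {n : ℕ} (κ : Kernel n)

/-- hard potentials: `γ ≥ -2s` -/
def Hard : Prop := -(2 * κ.s) ≤ κ.γ

/-- soft potentials: `-n < γ < -2s` -/
def Soft : Prop := -(n : ℝ) < κ.γ ∧ κ.γ < -(2 * κ.s)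

/-- the kernel `B(z,σ) = Φ(|z|) b(cos θ)`, `cos θ = z·σ/|z|` -/
def B (z σv : Vn n) : ℝ := κ.CΦ * ‖z‖ ^ κ.γ * κ.bang (⟪z, σv⟫ / ‖z‖)

/-- the Boltzmann collision operator -/
def Q (G F : Vn n → ℝ) (v : Vn n) : ℝ :=
  ∫ vs : Vn n, ∫ σv in Metric.sphere (0 : Vn n) 1,
    κ.B (v - vs) σv *
      (G ((2:ℝ)⁻¹ • (v + vs) - (‖v - vs‖ / 2) • σv) *
          F ((2:ℝ)⁻¹ • (v + vs) + (‖v - vs‖ / 2) • σv)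
        - G vs * F v) ∂(μH[(n : ℝ) - 1])

/-- the linearized Boltzmann operator `L g = -μ^{-1/2}Q(μ,√μ g) - μ^{-1/2}Q(√μ g, μ)` -/
def Lop (g : Vn n → ℝ) (v : Vn n) : ℝ :=
  -((Mx v) ^ (-(1:ℝ)/2) * κ.Q Mx (fun u => Real.sqrt (Mx u) * g u) v)
  - (Mx v) ^ (-(1:ℝ)/2) * κ.Q (fun u => Real.sqrt (Mx u) * g u) Mx v

/-- the bilinear collision operator `Γ(g,h) = μ^{-1/2} Q(√μ g, √μ h)` -/
def Gam (g h : Vn n → ℝ) (v : Vn n) : ℝ :=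
  (Mx v) ^ (-(1:ℝ)/2) *
    κ.Q (fun u => Real.sqrt (Mx u) * g u) (fun u => Real.sqrt (Mx u) * h u) v

/-- the unified velocity weight -/
def w (v : Vn n) : ℝ := if 0 ≤ κ.γ + 2 * κ.s then jap v else jap v ^ (-(κ.γ + 2 * κ.s))

end Kernel

/-- the orthogonal projection of `L²_v` onto `span{√μ, v_i √μ, (|v|²-n)√μ}` -/
def projP {n : ℕ} (g : Vn n → ℝ) (v : Vn n) : ℝ :=
  (∫ u : Vn n, Real.sqrt (Mx u) * g u) * Real.sqrt (Mx v)
  + (∑ i : Fin n, (∫ u : Vn n, u i * Real.sqrt (Mx u) * g u) * (v i * Real.sqrt (Mx v)))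
  + ((2 * (n : ℝ))⁻¹ * ∫ u : Vn n, (‖u‖ ^ 2 - (n : ℝ)) * Real.sqrt (Mx u) * g u) *
      ((‖v‖ ^ 2 - (n : ℝ)) * Real.sqrt (Mx v))

/-- the microscopic part `(I - P) g` of a function of `(x,v)` -/
def ImP {n : ℕ} (g : Vn n → Vn n → ℝ) : Vn n → Vn n → ℝ :=
  fun x v => g x v - projP (g x) v

/-- the anisotropic metric on the lifted paraboloid -/
def dmet {n : ℕ} (v v' : Vn n) : ℝ :=
  Real.sqrt (‖v - v'‖ ^ 2 + 4⁻¹ * (‖v‖ ^ 2 - ‖v'‖ ^ 2) ^ 2)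

/-- the squared weighted anisotropic norm `|g|²_{N^{s,γ}_ℓ}` -/
def Kernel.Nsq {n : ℕ} (κ : Kernel n) (ℓ : ℝ) (g : Vn n → ℝ) : ℝ :=
  (∫ v : Vn n, jap v ^ (κ.γ + 2 * κ.s) * (κ.w v ^ ℓ * g v) ^ 2)
  + ∫ v : Vn n, ∫ v' : Vn n,
      if dmet v v' ≤ 1 then
        jap v ^ (κ.γ + 2 * κ.s + 1) * κ.w v ^ (2 * ℓ) * (g v' - g v) ^ 2 /
          dmet v v' ^ ((n : ℝ) + 2 * κ.s)
      else 0

/-- `K*_n = ⌊n/2 + 1⌋` -/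
def Kstar (n : ℕ) : ℕ := n / 2 + 1

/-- directional derivative in the phase space `(x,v)` -/
def pderivP {n : ℕ} (d : Vn n × Vn n) (G : Vn n × Vn n → ℝ) : Vn n × Vn n → ℝ :=
  fun p => fderiv ℝ G p d

/-- length `|α|` of a multi-index -/
def mdeg {n : ℕ} (α : Fin n → ℕ) : ℕ := ∑ i, α i

/-- the phase space derivative `∂^α_β = ∂^α_x ∂^β_v` -/
def mderiv {n : ℕ} (α β : Fin n → ℕ) (G : Vn n × Vn n → ℝ) : Vn n × Vn n → ℝ :=
  (List.finRange n).foldr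
    (fun i F => (pderivP (EuclideanSpace.single i (1:ℝ), (0 : Vn n)))^[α i] F)
    ((List.finRange n).foldr
      (fun i F => (pderivP ((0 : Vn n), EuclideanSpace.single i (1:ℝ)))^[β i] F) G)

/-- pairs of multi-indices with `|α| + |β| ≤ K` -/
def multiIdx (n K : ℕ) : Finset ((Fin n → ℕ) × (Fin n → ℕ)) :=
  ((Fintype.piFinset fun _ => Finset.range (K + 1)) ×ˢ
      (Fintype.piFinset fun _ => Finset.range (K + 1))).filter
    fun p => mdeg p.1 + mdeg p.2 ≤ K

/-- multi-indices with `1 ≤ |α| ≤ K` -/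
def multiIdxA (n K : ℕ) : Finset (Fin n → ℕ) :=
  (Fintype.piFinset fun _ => Finset.range (K + 1)).filter fun α => 1 ≤ mdeg α ∧ mdeg α ≤ K

/-- `‖w^q g‖²_{L²(ℝⁿ_x × ℝⁿ_v)}` -/
def wL2sq {n : ℕ} (κ : Kernel n) (q : ℝ) (g : Vn n → Vn n → ℝ) : ℝ :=
  ∫ x : Vn n, ∫ v : Vn n, (κ.w v ^ q * g x v) ^ 2

/-- the reference instant energy `Σ_{|α|+|β| ≤ K} ‖w^{ℓ-|β|} ∂^α_β g‖²_{L²}` -/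
def refE {n : ℕ} (κ : Kernel n) (K : ℕ) (ℓ : ℝ) (g : Vn n → Vn n → ℝ) : ℝ :=
  ∑ p ∈ multiIdx n K,
    wL2sq κ (ℓ - (mdeg p.2 : ℝ)) fun x v => mderiv p.1 p.2 (fun q => g q.1 q.2) (x, v)

/-- the reference high-order instant energy -/
def refEh {n : ℕ} (κ : Kernel n) (K : ℕ) (ℓ : ℝ) (g : Vn n → Vn n → ℝ) : ℝ :=
  (∑ α ∈ multiIdxA n K, wL2sq κ ℓ fun x v => mderiv α 0 (fun q => g q.1 q.2) (x, v))
  + ∑ p ∈ multiIdx n K,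
      wL2sq κ (ℓ - (mdeg p.2 : ℝ)) fun x v => mderiv p.1 p.2 (fun q => ImP g q.1 q.2) (x, v)

/-- the dissipation rate `D_{K,ℓ}` -/
def refD {n : ℕ} (κ : Kernel n) (K : ℕ) (ℓ : ℝ) (g : Vn n → Vn n → ℝ) : ℝ :=
  (∑ α ∈ multiIdxA n K,
    ∫ x : Vn n, κ.Nsq ℓ fun v => mderiv α 0 (fun q => g q.1 q.2) (x, v))
  + ∑ p ∈ multiIdx n K,
      ∫ x : Vn n,
        κ.Nsq (ℓ - (mdeg p.2 : ℝ)) fun v => mderiv p.1 p.2 (fun q => ImP g q.1 q.2) (x, v)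

/-- `‖∇ₓ P g‖²_{L²(ℝⁿ_x × ℝⁿ_v)}` -/
def gradPXsq {n : ℕ} (g : Vn n → Vn n → ℝ) : ℝ :=
  ∑ i : Fin n, ∫ x : Vn n, ∫ v : Vn n,
    (fderiv ℝ (fun x' => projP (g x') v) x (EuclideanSpace.single i (1:ℝ))) ^ 2

/-- `‖g‖²_{Z_r} = ‖g‖²_{L²_v(L^r_x)}` -/
def ZrSq {n : ℕ} (r : ℝ) (g : Vn n → Vn n → ℝ) : ℝ :=
  ∫ v : Vn n, (∫ x : Vn n, |g x v| ^ r) ^ (2 / r)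

/-- `‖g‖²_{Z_∞} = ‖g‖²_{L²_v(L^∞_x)}` -/
def ZinfSq {n : ℕ} (g : Vn n → Vn n → ℝ) : ℝ :=
  ∫ v : Vn n, (essSup (fun x => (|g x v| : ℝ)) volume) ^ 2

/-- `f` solves the perturbed Boltzmann equation `∂_t f + v·∇_x f + L f = Γ(f,f)`, `f(0) = f₀` -/
def IsSolution {n : ℕ} (κ : Kernel n) (f : ℝ → Vn n → Vn n → ℝ)
    (f0 : Vn n → Vn n → ℝ) : Prop :=
  (∀ x v, f 0 x v = f0 x v) ∧
  ∀ t, 0 ≤ t → ∀ (x v : Vn n),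
    deriv (fun τ => f τ x v) t
      + (∑ i : Fin n, v i * fderiv ℝ (fun x' => f t x' v) x (EuclideanSpace.single i (1:ℝ)))
      + κ.Lop (fun u => f t x u) v
      = κ.Gam (fun u => f t x u) (fun u => f t x u) v

/-- `f` solves the linearized equation `∂_t f + v·∇_x f + L f = 0`, `f(0) = f₀` -/
def IsLinSolution {n : ℕ} (κ : Kernel n) (f : ℝ → Vn n → Vn n → ℝ)
    (f0 : Vn n → Vn n → ℝ) : Prop :=
  (∀ x v, f 0 x v = f0 x v) ∧
  ∀ t, 0 ≤ t → ∀ (x v : Vn n),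
    deriv (fun τ => f τ x v) t
      + (∑ i : Fin n, v i * fderiv ℝ (fun x' => f t x' v) x (EuclideanSpace.single i (1:ℝ)))
      + κ.Lop (fun u => f t x u) v = 0

/-- `f` is a global solution of the nonlinear problem as provided by the small-data
existence theorem: it comes with instant energy functionals satisfying the
Lyapunov inequalities for every weight `ℓ ≥ 0`. -/
def GoodSolution {n : ℕ} (κ : Kernel n) (K : ℕ)
    (f : ℝ → Vn n → Vn n → ℝ) (f0 : Vn n → Vn n → ℝ) : Prop :=
  IsSolution κ f f0 ∧
  ∀ ℓ : ℝ, 0 ≤ ℓ →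
    ∃ (E : (Vn n → Vn n → ℝ) → ℝ) (C lam : ℝ), 0 < C ∧ 0 < lam ∧
      (∀ g, C⁻¹ * refE κ K ℓ g ≤ E g ∧ E g ≤ C * refE κ K ℓ g) ∧
      Continuous (fun t => E (f t)) ∧
      ∀ t, 0 ≤ t → deriv (fun τ => E (f τ)) t + lam * refD κ K ℓ (f t) ≤ 0

/-- `ε_{K,ℓ} = E_{K,ℓ}(0) + ‖f₀‖²_{Z₁}` -/
def epsE {n : ℕ} (κ : Kernel n) (K : ℕ) (ℓ : ℝ) (f0 : Vn n → Vn n → ℝ) : ℝ :=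
  refE κ K ℓ f0 + ZrSq 1 f0

/-- `‖g‖²_{Ḣ^m} = ∫∫ |k|^{2m} |ĝ(k,v)|² dk dv` -/
def hdotSq {n : ℕ} (m : ℝ) (g : Vn n → Vn n → ℝ) : ℝ :=
  ∫ v : Vn n, ∫ k : Vn n, ‖k‖ ^ (2 * m) * ‖𝓕 (fun x => (g x v : ℂ)) k‖ ^ 2

/-- the `L²_v(H^m_x)` norm squared `‖g‖²_{𝓗^m}` -/
def HmXsq {n : ℕ} (m : ℝ) (g : Vn n → Vn n → ℝ) : ℝ :=
  ∫ v : Vn n, ∫ k : Vn n, (1 + ‖k‖ ^ 2) ^ m * ‖𝓕 (fun x => (g x v : ℂ)) k‖ ^ 2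

/-- the weighted velocity Sobolev norm squared `|g|²_{H^m_ℓ} = ∫ ⟨v⟩^ℓ |(I-Δ)^{m/2} g|²` -/
def HmlSq {n : ℕ} (m ℓ : ℝ) (g : Vn n → ℝ) : ℝ :=
  ∫ v : Vn n, jap v ^ ℓ *
    ‖𝓕⁻ (fun ξ : Vn n => (((1 + 4 * Real.pi ^ 2 * ‖ξ‖ ^ 2) ^ (m / 2) : ℝ) : ℂ) *
        𝓕 (fun u : Vn n => (g u : ℂ)) ξ) v‖ ^ 2

/-- the weighted `L²` norm squared `|g|²_{L²_ℓ} = ∫ ⟨v⟩^ℓ |g|²` -/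
def L2wSq {n : ℕ} (ℓ : ℝ) (g : Vn n → ℝ) : ℝ := ∫ v : Vn n, jap v ^ ℓ * (g v) ^ 2

end

/-- Pointwise domination of `|k|^{2mp} |h(|k|²t)|^p` by a rescaled power of the bracket. -/
lemma rpow_mul_abs_rpow_le_of_decay {h : ℝ → ℝ} {m p Ch j : ℝ} (hm : 0 ≤ m) (hp : 0 < p)
    (hCh : 0 < Ch) (hbound : ∀ s : ℝ, 0 ≤ s → |h s| ≤ Ch * (1 + s) ^ (-j))
    {x t : ℝ} (hx : 0 ≤ x) (ht : 0 < t) :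
    x ^ (2 * m * p) * |h (x ^ 2 * t)| ^ p ≤
      Ch ^ p * t ^ (-(m * p)) * (1 + x ^ 2 * t) ^ (-((j - m) * p)) := by
  have hs : 0 ≤ x ^ 2 * t := by positivity
  have h1 : |h (x ^ 2 * t)| ^ p ≤ Ch ^ p * (1 + x ^ 2 * t) ^ (-(j * p)) := by
    refine (rpow_le_rpow (abs_nonneg _) (hbound _ hs) hp.le).trans_eq ?_
    rw [mul_rpow hCh.le (by positivity), ← rpow_mul (by positivity), neg_mul]
  have h2 : x ^ (2 * m * p) ≤ t ^ (-(m * p)) * (1 + x ^ 2 * t) ^ (m * p) := by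
    have h3 : x ^ (2 * m * p) = t ^ (-(m * p)) * (x ^ 2 * t) ^ (m * p) := by
      rw [mul_rpow (by positivity) ht.le, mul_left_comm, ← rpow_add ht, neg_add_cancel,
        rpow_zero, mul_one, ← rpow_natCast, ← rpow_mul hx]
      push_cast
      ring_nf
    rw [h3]
    gcongr
    linarith
  calc x ^ (2 * m * p) * |h (x ^ 2 * t)| ^ p
      ≤ (t ^ (-(m * p)) * (1 + x ^ 2 * t) ^ (m * p)) *
          (Ch ^ p * (1 + x ^ 2 * t) ^ (-(j * p))) := by gcongr
    _ = Ch ^ p * t ^ (-(m * p)) *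
          ((1 + x ^ 2 * t) ^ (m * p) * (1 + x ^ 2 * t) ^ (-(j * p))) := by ring
    _ = _ := by
      rw [← rpow_add (by positivity)]
      ring_nf

/-- Scaling of the weighted integral of a decaying profile, over any set. -/
lemma exists_setIntegral_le_rpow_of_decay (n : ℕ) {h : ℝ → ℝ} {m p Ch j : ℝ} (hm : 0 ≤ m)
    (hp : 0 < p) (hCh : 0 < Ch) (hj : n < 2 * ((j - m) * p))
    (hbound : ∀ s : ℝ, 0 ≤ s → |h s| ≤ Ch * (1 + s) ^ (-j)) :
    ∃ I : ℝ, 0 ≤ I ∧ ∀ (S : Set (Vn n)) (t : ℝ), 0 < t →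
      ∫ k in S, ‖k‖ ^ (2 * m * p) * |h (‖k‖ ^ 2 * t)| ^ p ≤
        I * t ^ (-(m * p + n / 2)) := by
  set Φ : Vn n → ℝ := fun y => (1 + ‖y‖ ^ 2) ^ (-((j - m) * p)) with hΦ
  have hΦ0 : ∀ y, 0 ≤ Φ y := fun y => by positivity
  have hΦi : Integrable Φ := by
    have := integrable_rpow_neg_one_add_norm_sq (E := Vn n) (μ := volume)
      (r := 2 * ((j - m) * p)) (by simpa using hj)
    refine this.congr (.of_forall fun y => ?_)
    simp only [hΦ]
    ring_nf
  refine ⟨Ch ^ p * ∫ y, Φ y, mul_nonneg (by positivity) (integral_nonneg hΦ0), ?_⟩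
  intro S t ht
  have hst : 0 < √t := sqrt_pos.2 ht
  have hcomp : Integrable fun k : Vn n => Ch ^ p * t ^ (-(m * p)) * Φ (√t • k) :=
    (hΦi.comp_smul hst.ne').const_mul _
  calc ∫ k in S, ‖k‖ ^ (2 * m * p) * |h (‖k‖ ^ 2 * t)| ^ p
      ≤ ∫ k in S, Ch ^ p * t ^ (-(m * p)) * Φ (√t • k) := by
        refine integral_mono_of_nonneg (.of_forall fun k => by positivity)
          hcomp.integrableOn (.of_forall fun k => ?_)
        have := rpow_mul_abs_rpow_le_of_decay hm hp hCh hbound (norm_nonneg k) ht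
        simpa [hΦ, norm_smul, mul_pow, abs_of_pos hst, sq_sqrt ht.le, mul_comm t] using this
    _ ≤ ∫ k, Ch ^ p * t ^ (-(m * p)) * Φ (√t • k) :=
        setIntegral_le_integral hcomp
          (.of_forall fun k => mul_nonneg (by positivity) (hΦ0 _))
    _ = Ch ^ p * t ^ (-(m * p)) * (t ^ (-((n : ℝ) / 2)) * ∫ y, Φ y) := by
        rw [integral_const_mul, Measure.integral_comp_smul_of_nonneg _ _ (hR := hst.le),
          finrank_euclideanSpace_fin, smul_eq_mul, sqrt_eq_rpow, ← rpow_natCast,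
          ← rpow_mul ht.le, ← rpow_neg ht.le]
        ring_nf
    _ = _ := by
        rw [neg_add, rpow_add ht]
        ring

/-- the Hölder-factor estimate
`(∫_{|k|≤1} |k|^{2mr/(2-r)} |h(|k|²t)|^{r/(2-r)} dk)^{(2-r)/r} ≤ C t^{-2σ_{r,m}}`. -/
theorem stmt16 (n : ℕ) (hn : 1 ≤ n) (m r : ℝ) (hm : 0 ≤ m)
    (hr1 : 1 < r) (hr2 : r < 2) (h : ℝ → ℝ) (hmeas : Measurable h)
    (Ch j : ℝ) (hCh : 0 < Ch)
    (hj : 2 * (((n : ℝ) / 2) * (1 / r - 1 / 2) + m / 2) < j)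
    (hbound : ∀ s : ℝ, 0 ≤ s → |h s| ≤ Ch * (1 + s) ^ (-j)) :
    ∃ C : ℝ, 0 < C ∧
      ∀ t : ℝ, 1 ≤ t →
        (∫ k in Metric.closedBall (0 : Vn n) 1,
            ‖k‖ ^ (2 * m * r / (2 - r)) * |h (‖k‖ ^ 2 * t)| ^ (r / (2 - r))) ^
            ((2 - r) / r) ≤
          C * t ^ (-2 * (((n : ℝ) / 2) * (1 / r - 1 / 2) + m / 2)) := by
  set p := r / (2 - r) with hp_def
  have h2r : 0 < 2 - r := by linarith
  have hr0 : 0 < r := by linarith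
  have hp : 0 < p := div_pos hr0 h2r
  have hinv : (2 - r) / r = p⁻¹ := by rw [hp_def, inv_div]
  have hσ : 2 * (((n : ℝ) / 2) * (1 / r - 1 / 2) + m / 2) = m + n / 2 * p⁻¹ := by
    rw [← hinv]
    field_simp
    ring
  rw [hσ] at hj
  have hj' : (n : ℝ) < 2 * ((j - m) * p) := by
    have h1 : (n : ℝ) / 2 * p⁻¹ < j - m := by linarith
    rw [← div_eq_mul_inv, div_lt_iff₀ hp] at h1
    linarith
  obtain ⟨I, hI0, hI⟩ := exists_setIntegral_le_rpow_of_decay n hm hp hCh hj' hbound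
  refine ⟨I ^ p⁻¹ + 1, by positivity, fun t ht => ?_⟩
  have ht0 : 0 < t := by linarith
  rw [hinv, neg_mul, hσ, mul_div_assoc, ← hp_def]
  calc _ ≤ (I * t ^ (-(m * p + n / 2))) ^ p⁻¹ :=
        rpow_le_rpow (integral_nonneg fun k => by positivity) (hI _ t ht0) (by positivity)
    _ = I ^ p⁻¹ * t ^ (-(m + n / 2 * p⁻¹)) := by
        rw [mul_rpow hI0 (by positivity), ← rpow_mul ht0.le]
        congr 2
        field_simp
    _ ≤ _ := by
        gcongr
        linarith
end

section
/- For every λ > 0, every p ∈ (0,1] and every σ ≥ 0, there exists a constant C = C(λ,p,σ) such that for all t ≥ 0, ∫₀ᵗ e^{−λ(t^p − s^p)} s^{p−1} (1+s)^{−σ} ds ≤ C (1+t)^{−σ}. -/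
open MeasureTheory Real Function
open scoped RealInnerProductSpace FourierTransform ENNReal

/-- Polynomial growth is dominated by exponential growth, with an explicit constant. -/
theorem two_mul_one_add_rpow_le_mul_exp {a c x : ℝ} (ha : 0 ≤ a) (hc : 0 < c) (hx : 0 ≤ x) :
    (2 * (1 + x)) ^ a ≤ (2 * (1 + (a + 1) / c)) ^ (a + 1) * Real.exp (c * x) := by
  have hb : 0 < a + 1 := by linarith
  have hlin : 1 + x ≤ (1 + (a + 1) / c) * Real.exp (c / (a + 1) * x) := by
    have hexp := Real.add_one_le_exp (c / (a + 1) * x)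
    have hcancel : (a + 1) / c * (c / (a + 1) * x) = x := by field_simp
    have hy : 0 ≤ c / (a + 1) * x := by positivity
    have hinv : 0 ≤ (a + 1) / c := by positivity
    nlinarith [mul_le_mul_of_nonneg_left hexp (by linarith : 0 ≤ 1 + (a + 1) / c)]
  calc (2 * (1 + x)) ^ a ≤ (2 * (1 + x)) ^ (a + 1) :=
        Real.rpow_le_rpow_of_exponent_le (by linarith) (by linarith)
    _ ≤ (2 * (1 + (a + 1) / c) * Real.exp (c / (a + 1) * x)) ^ (a + 1) :=
        Real.rpow_le_rpow (by positivity) (by linarith) hb.le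
    _ = (2 * (1 + (a + 1) / c)) ^ (a + 1) * Real.exp (c * x) := by
        rw [Real.mul_rpow (by positivity) (Real.exp_pos _).le, ← Real.exp_mul]
        congr 2
        field_simp

theorem one_add_div_rpow_le {p s t : ℝ} (hp : 0 < p) (hp' : p ≤ 1) (hs : 0 ≤ s) (hst : s ≤ t) :
    ((1 + t) / (1 + s)) ^ p ≤ 2 * (1 + (t ^ p - s ^ p)) := by
  have ht : 0 ≤ t := hs.trans hst
  have hmono : s ^ p ≤ t ^ p := Real.rpow_le_rpow hs hst hp.le
  have hsub : (1 + t) ^ p ≤ 1 + t ^ p := by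
    simpa using Real.rpow_add_le_add_rpow zero_le_one ht hp.le hp'
  have hone : 1 ≤ (1 + s) ^ p := Real.one_le_rpow (by linarith) hp.le
  have hle : s ^ p ≤ (1 + s) ^ p := Real.rpow_le_rpow hs (by linarith) hp.le
  rw [Real.div_rpow (by linarith) (by linarith), div_le_iff₀ (by linarith)]
  nlinarith [mul_nonneg (sub_nonneg.2 hmono) (sub_nonneg.2 hone)]

/-- Peetre-type inequality for the weight `(1+s)^{-σ}` at the price of a stretched exponential. -/
theorem one_add_rpow_neg_le {c p σ s t : ℝ} (hc : 0 < c) (hp : 0 < p) (hp' : p ≤ 1)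
    (hσ : 0 ≤ σ) (hs : 0 ≤ s) (hst : s ≤ t) :
    (1 + s) ^ (-σ) ≤ (2 * (1 + (σ / p + 1) / c)) ^ (σ / p + 1) *
      Real.exp (c * (t ^ p - s ^ p)) * (1 + t) ^ (-σ) := by
  have hs1 : 0 < 1 + s := by linarith
  have ht1 : 0 < 1 + t := by linarith
  have hratio : ((1 + t) / (1 + s)) ^ σ ≤
      (2 * (1 + (σ / p + 1) / c)) ^ (σ / p + 1) * Real.exp (c * (t ^ p - s ^ p)) :=
    calc ((1 + t) / (1 + s)) ^ σ = (((1 + t) / (1 + s)) ^ p) ^ (σ / p) := by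
          rw [← Real.rpow_mul (by positivity), mul_div_cancel₀ _ hp.ne']
      _ ≤ (2 * (1 + (t ^ p - s ^ p))) ^ (σ / p) :=
          Real.rpow_le_rpow (by positivity) (one_add_div_rpow_le hp hp' hs hst) (by positivity)
      _ ≤ _ := two_mul_one_add_rpow_le_mul_exp (by positivity) hc
          (sub_nonneg.2 (Real.rpow_le_rpow hs hst hp.le))
  calc (1 + s) ^ (-σ) = ((1 + t) / (1 + s)) ^ σ * (1 + t) ^ (-σ) := by
        rw [Real.div_rpow ht1.le hs1.le, Real.rpow_neg hs1.le, Real.rpow_neg ht1.le]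
        field_simp
    _ ≤ _ := by gcongr

theorem integrableOn_and_integral_exp_mul_rpow_le {c p t : ℝ} (hc : 0 < c) (hp : 0 < p)
    (ht : 0 ≤ t) :
    IntegrableOn (fun s => Real.exp (-c * (t ^ p - s ^ p)) * s ^ (p - 1)) (Set.Ioo 0 t) ∧
      ∫ s in Set.Ioo 0 t, Real.exp (-c * (t ^ p - s ^ p)) * s ^ (p - 1) ≤ 1 / (c * p) := by
  have hcont : ContinuousOn (fun s => 1 / (c * p) * Real.exp (-c * (t ^ p - s ^ p)))
      (Set.Icc 0 t) := by
    have := Real.continuous_rpow_const hp.le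
    fun_prop
  have hderiv : ∀ s ∈ Set.Ioo 0 t,
      HasDerivAt (fun s => 1 / (c * p) * Real.exp (-c * (t ^ p - s ^ p)))
        (Real.exp (-c * (t ^ p - s ^ p)) * s ^ (p - 1)) s := by
    intro s hs
    have h := ((((Real.hasDerivAt_rpow_const (p := p) (Or.inl hs.1.ne')).const_sub
      (t ^ p)).const_mul (-c)).exp).const_mul (1 / (c * p))
    refine h.congr_deriv ?_
    field_simp
  have hint : IntegrableOn (fun s => Real.exp (-c * (t ^ p - s ^ p)) * s ^ (p - 1))
      (Set.Ioc 0 t) :=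
    intervalIntegral.integrableOn_deriv_of_nonneg hcont hderiv fun s hs =>
      mul_nonneg (Real.exp_pos _).le (Real.rpow_nonneg hs.1.le _)
  refine ⟨hint.mono_set Set.Ioo_subset_Ioc_self, ?_⟩
  rw [← integral_Ioc_eq_integral_Ioo, ← intervalIntegral.integral_of_le ht,
    intervalIntegral.integral_eq_sub_of_hasDerivAt_of_le ht hcont hderiv
      ((intervalIntegrable_iff_integrableOn_Ioc_of_le ht).2 hint)]
  have : 0 ≤ 1 / (c * p) * Real.exp (-c * (t ^ p - 0 ^ p)) := by positivity
  simpa using this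

/-- the convolution-type time-decay estimate
`∫₀ᵗ e^{-λ(t^p - s^p)} s^{p-1} (1+s)^{-σ} ds ≤ C (1+t)^{-σ}`. -/
theorem stmt18 (lam p σ : ℝ) (hlam : 0 < lam) (hp1 : 0 < p) (hp2 : p ≤ 1)
    (hσ : 0 ≤ σ) :
    ∃ C : ℝ, 0 < C ∧
      ∀ t : ℝ, 0 ≤ t →
        (∫ s in Set.Ioo (0 : ℝ) t,
            Real.exp (-lam * (t ^ p - s ^ p)) * s ^ (p - 1) * (1 + s) ^ (-σ)) ≤
          C * (1 + t) ^ (-σ) := by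
  have hc : 0 < lam / 2 := half_pos hlam
  set K : ℝ := (2 * (1 + (σ / p + 1) / (lam / 2))) ^ (σ / p + 1)
  have hK : 0 < K := by positivity
  refine ⟨K * (1 / (lam / 2 * p)), by positivity, fun t ht => ?_⟩
  obtain ⟨hint, hle⟩ := integrableOn_and_integral_exp_mul_rpow_le hc hp1 ht
  calc (∫ s in Set.Ioo (0 : ℝ) t,
          Real.exp (-lam * (t ^ p - s ^ p)) * s ^ (p - 1) * (1 + s) ^ (-σ))
      ≤ ∫ s in Set.Ioo (0 : ℝ) t, K * (1 + t) ^ (-σ) *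
          (Real.exp (-(lam / 2) * (t ^ p - s ^ p)) * s ^ (p - 1)) := by
        refine integral_mono_of_nonneg ?_ (hint.const_mul _) ?_
        all_goals
          filter_upwards [ae_restrict_mem measurableSet_Ioo] with s hs
          have hs0 : 0 < s := hs.1
        · simp only [Pi.zero_apply]
          positivity
        · calc Real.exp (-lam * (t ^ p - s ^ p)) * s ^ (p - 1) * (1 + s) ^ (-σ)
              ≤ Real.exp (-lam * (t ^ p - s ^ p)) * s ^ (p - 1) *
                  (K * Real.exp (lam / 2 * (t ^ p - s ^ p)) * (1 + t) ^ (-σ)) := by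
                gcongr
                exact one_add_rpow_neg_le hc hp1 hp2 hσ hs0.le hs.2.le
            _ = K * (1 + t) ^ (-σ) *
                  (Real.exp (-lam * (t ^ p - s ^ p) + lam / 2 * (t ^ p - s ^ p)) *
                    s ^ (p - 1)) := by
                rw [Real.exp_add]
                ring
            _ = _ := by
                congr 3
                ring
    _ = K * (1 + t) ^ (-σ) * ∫ s in Set.Ioo (0 : ℝ) t,
          Real.exp (-(lam / 2) * (t ^ p - s ^ p)) * s ^ (p - 1) := integral_const_mul _ _
    _ ≤ K * (1 + t) ^ (-σ) * (1 / (lam / 2 * p)) := by gcongr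
    _ = K * (1 / (lam / 2 * p)) * (1 + t) ^ (-σ) := by ring
end
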